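/- Let A be a real m×n matrix, μ ≥ 0 and γ > 0, and let λ_min be the smallest eigenvalue of AᵀA. Suppose 0 < γ − μ² < 2√γ (μ² + λ_min) / (γ + λ_min). Then every z in the field of values F(K T⁻¹), where K = [I_m, A; −Aᵀ, μ² I_n] and T = [I_m, A; −Aᵀ, γ I_n], satisfies Re(z) > 0; in particular 0 ∉ F(K T⁻¹). -/

import Mathlib

open Matrix
open scoped ComplexInnerProductSpace

/-- The field of values of a real square matrix, taken over complex vectors. -/
noncomputable def fov {ι : Type} [Fintype ι] [DecidableEq ι] (W : Matrix ι ι ℝ) : Set ℂ :=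
  {z | ∃ y : EuclideanSpace ℂ ι, y ≠ 0 ∧
    z = ⟪(Matrix.toEuclideanLin (W.map Complex.ofReal)) y, y⟫ / ⟪y, y⟫}

section

variable {ι κ : Type} [Fintype ι] [Fintype κ]

lemma re_inner_toEuclideanLin_map_ofReal [DecidableEq ι] (W : Matrix ι ι ℝ)
    (y : EuclideanSpace ℂ ι) :
    (⟪(Matrix.toEuclideanLin (W.map Complex.ofReal)) y, y⟫).re =
      (fun i => (y i).re) ⬝ᵥ (W *ᵥ fun i => (y i).re) +
        (fun i => (y i).im) ⬝ᵥ (W *ᵥ fun i => (y i).im) := by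
  simp only [PiLp.inner_apply, Complex.re_sum, dotProduct, ← Finset.sum_add_distrib]
  refine Finset.sum_congr rfl fun i _ => ?_
  simp [Matrix.toLpLin_apply, mulVec, dotProduct, Complex.re_sum, Complex.im_sum]

/-- A real matrix with positive definite symmetric part has its field of values in the open
right half-plane. -/
lemma re_pos_of_mem_fov [DecidableEq ι] {W : Matrix ι ι ℝ}
    (hW : ∀ v : ι → ℝ, v ≠ 0 → 0 < v ⬝ᵥ (W *ᵥ v)) {z : ℂ} (hz : z ∈ fov W) : 0 < z.re := by
  obtain ⟨y, hy, rfl⟩ := hz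
  have hW0 (v : ι → ℝ) : 0 ≤ v ⬝ᵥ (W *ᵥ v) := by
    rcases eq_or_ne v 0 with rfl | hv
    · simp
    · exact (hW v hv).le
  have hnum : 0 < (⟪(Matrix.toEuclideanLin (W.map Complex.ofReal)) y, y⟫).re := by
    rw [re_inner_toEuclideanLin_map_ofReal]
    by_cases hre : (fun i => (y i).re) = 0
    · have him : (fun i => (y i).im) ≠ 0 := fun him =>
        hy (by ext i; exact Complex.ext (congrFun hre i) (congrFun him i))
      exact add_pos_of_nonneg_of_pos (hW0 _) (hW _ him)
    · exact add_pos_of_pos_of_nonneg (hW _ hre) (hW0 _)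
  rw [inner_self_eq_norm_sq_to_K]
  have hy' : 0 < ‖y‖ ^ 2 := by positivity
  have : ((‖y‖ : ℂ)) ^ 2 = ((‖y‖ ^ 2 : ℝ) : ℂ) := by push_cast; rfl
  erw [this, Complex.div_ofReal_re]
  exact div_pos hnum hy'

lemma isUnit_of_dotProduct_mulVec_pos [DecidableEq ι] {M : Matrix ι ι ℝ}
    (hM : ∀ v : ι → ℝ, v ≠ 0 → 0 < v ⬝ᵥ (M *ᵥ v)) : IsUnit M := by
  rw [← Matrix.mulVec_injective_iff_isUnit]
  intro x y hxy
  by_contra hne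
  have h := hM (x - y) (sub_ne_zero.2 hne)
  have hxy' : M *ᵥ x = M *ᵥ y := hxy
  rw [mulVec_sub, hxy', sub_self, dotProduct_zero] at h
  exact h.false

lemma iInf_eigenvalues_mul_le [DecidableEq ι] {M : Matrix ι ι ℝ} (hM : M.IsHermitian)
    (w : ι → ℝ) : (⨅ i, hM.eigenvalues i) * (w ⬝ᵥ w) ≤ w ⬝ᵥ (M *ᵥ w) := by
  set b := hM.eigenvectorBasis
  have key (x y : ι → ℝ) :
      x ⬝ᵥ y = ∑ i, (x ⬝ᵥ (b i).ofLp) * (y ⬝ᵥ (b i).ofLp) := by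
    have h := b.sum_inner_mul_inner (WithLp.toLp 2 x) (WithLp.toLp 2 y)
    simp only [EuclideanSpace.inner_eq_star_dotProduct, star_trivial] at h
    rw [dotProduct_comm x y, ← h]
    exact Finset.sum_congr rfl fun i _ => by rw [dotProduct_comm x]
  have hT : Mᵀ = M := by simpa [Matrix.IsHermitian, conjTranspose_eq_transpose_of_trivial] using hM
  have heig (i : ι) : (M *ᵥ w) ⬝ᵥ (b i).ofLp = hM.eigenvalues i * (w ⬝ᵥ (b i).ofLp) := by
    rw [dotProduct_comm, dotProduct_mulVec, ← mulVec_transpose, hT, hM.mulVec_eigenvectorBasis i,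
      smul_dotProduct, smul_eq_mul, dotProduct_comm]
  rw [key w w, key w (M *ᵥ w), Finset.mul_sum]
  refine Finset.sum_le_sum fun i _ => ?_
  rw [heig]
  have hle := ciInf_le (Set.finite_range hM.eigenvalues).bddBelow i
  nlinarith [mul_le_mul_of_nonneg_right hle (mul_self_nonneg (w ⬝ᵥ (b i).ofLp))]

lemma dotProduct_self_nonneg_real (v : ι → ℝ) : 0 ≤ v ⬝ᵥ v :=
  Finset.sum_nonneg fun i _ => mul_self_nonneg (v i)

lemma dotProduct_self_pos_real {v : ι → ℝ} (hv : v ≠ 0) : 0 < v ⬝ᵥ v :=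
  (dotProduct_self_nonneg_real v).lt_of_ne fun h => hv (dotProduct_self_eq_zero.1 h.symm)

lemma dotProduct_sq_le (x y : ι → ℝ) : (x ⬝ᵥ y) ^ 2 ≤ (x ⬝ᵥ x) * (y ⬝ᵥ y) := by
  simpa [dotProduct, sq] using Finset.sum_mul_sq_le_sq_mul_sq Finset.univ x y

lemma mulVec_dotProduct_self (A : Matrix ι κ ℝ) (w : κ → ℝ) :
    (A *ᵥ w) ⬝ᵥ (A *ᵥ w) = w ⬝ᵥ ((Aᵀ * A) *ᵥ w) := by
  rw [← mulVec_mulVec, dotProduct_mulVec w, vecMul_transpose]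

lemma scalar_bound {p δ l t : ℝ} (hp : 0 < p) (hδ : 0 < δ) (hl : 0 ≤ l) (hlt : l ≤ t)
    (h : δ * (p ^ 2 + l + 2 * p) < 2 * p * (p ^ 2 + l)) :
    0 < (p ^ 2 + t) ^ 2 - δ * (p ^ 2 + t) - δ ^ 2 / 4 * t := by
  have hδp : δ < 2 * p := by
    by_contra! hc
    have : 0 < p ^ 2 + l := by positivity
    nlinarith [mul_le_mul_of_nonneg_right hc this.le, mul_pos hδ hp]
  have ht : 0 ≤ t := hl.trans hlt
  set s := p ^ 2 + t with hs
  have hs0 : 0 < s := by positivity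
  have hE : δ * (s + 2 * p) < 2 * p * s := by
    nlinarith [mul_le_mul_of_nonneg_right hδp.le (sub_nonneg.2 hlt)]
  have hk : 0 < s + 2 * p := by positivity
  have hE0 : 0 < δ * (s + 2 * p) := by positivity
  set E := δ * (s + 2 * p)
  have hE2 : E ^ 2 ≤ (2 * p * s) ^ 2 := by gcongr
  have h1 : E * (s * (s + 2 * p)) ≤ 2 * p * s * (s * (s + 2 * p)) := by gcongr
  have h2 : E ^ 2 * t ≤ (2 * p * s) ^ 2 * t := by gcongr
  have h3 : 0 < s ^ 2 * (s ^ 2 + 2 * p * s - p ^ 2 * t) := by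
    have : 0 < s ^ 2 + 2 * p * s - p ^ 2 * t := by
      have : 0 < p * s := by positivity
      have : 0 ≤ p ^ 2 * t := by positivity
      nlinarith [sq_nonneg (p ^ 2), sq_nonneg t]
    positivity
  have h4 : 0 < (s + 2 * p) ^ 2 * (s ^ 2 - δ * s - δ ^ 2 / 4 * t) := by
    have : (s + 2 * p) ^ 2 * (s ^ 2 - δ * s - δ ^ 2 / 4 * t) =
      s ^ 2 * (s + 2 * p) ^ 2 - E * (s * (s + 2 * p)) - E ^ 2 * t / 4 := by ring
    rw [this]
    nlinarith
  exact pos_of_mul_pos_right h4 (by positivity)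

/-- Positivity of `‖S w‖² - δ ⟨S w, w⟩ - (δ² / 4) ‖A w‖²` for `S = p² + AᵀA`. -/
lemma shifted_gram_pos [DecidableEq κ] (A : Matrix ι κ ℝ) {p δ l : ℝ} (hp : 0 < p) (hδ : 0 < δ)
    (hl : 0 ≤ l) (h : δ * (p ^ 2 + l + 2 * p) < 2 * p * (p ^ 2 + l)) {w : κ → ℝ} (hw : w ≠ 0)
    (hlw : l * (w ⬝ᵥ w) ≤ (A *ᵥ w) ⬝ᵥ (A *ᵥ w)) {r : κ → ℝ}
    (hr : r = p ^ 2 • w + (Aᵀ * A) *ᵥ w) :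
    0 < r ⬝ᵥ r - δ * (r ⬝ᵥ w) - δ ^ 2 / 4 * ((A *ᵥ w) ⬝ᵥ (A *ᵥ w)) := by
  have hN := dotProduct_self_pos_real hw
  have hQ := mulVec_dotProduct_self A w
  have hCS := dotProduct_sq_le w ((Aᵀ * A) *ᵥ w)
  rw [← hQ] at hCS
  have hrw : r ⬝ᵥ w = p ^ 2 * (w ⬝ᵥ w) + (A *ᵥ w) ⬝ᵥ (A *ᵥ w) := by
    rw [hr, add_dotProduct, smul_dotProduct, smul_eq_mul, hQ, dotProduct_comm ((Aᵀ * A) *ᵥ w)]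
  have hrr : r ⬝ᵥ r = p ^ 4 * (w ⬝ᵥ w) + 2 * p ^ 2 * ((A *ᵥ w) ⬝ᵥ (A *ᵥ w)) +
      ((Aᵀ * A) *ᵥ w) ⬝ᵥ ((Aᵀ * A) *ᵥ w) := by
    rw [hr, hQ]
    simp only [add_dotProduct, dotProduct_add, smul_dotProduct, dotProduct_smul, smul_eq_mul,
      dotProduct_comm ((Aᵀ * A) *ᵥ w) w]
    ring
  rw [hrw, hrr]
  generalize ((Aᵀ * A) *ᵥ w) ⬝ᵥ ((Aᵀ * A) *ᵥ w) = R at *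
  generalize (A *ᵥ w) ⬝ᵥ (A *ᵥ w) = Q at *
  generalize w ⬝ᵥ w = N at *
  have hs := scalar_bound hp hδ hl ((le_div_iff₀ hN).2 hlw) h
  have hR : Q ^ 2 / N ≤ R := (div_le_iff₀ hN).2 (by linarith)
  have hs' := mul_pos hN hs
  have : N * ((p ^ 2 + Q / N) ^ 2 - δ * (p ^ 2 + Q / N) - δ ^ 2 / 4 * (Q / N)) =
      p ^ 4 * N + 2 * p ^ 2 * Q + Q ^ 2 / N - δ * (p ^ 2 * N + Q) - δ ^ 2 / 4 * Q := by
    field_simp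
    ring
  linarith

end

/-- If `0 < γ − μ² < 2√γ (μ² + λ_min)/(γ + λ_min)`, where `λ_min` is the smallest eigenvalue
of `AᵀA`, then every `z ∈ F(K T⁻¹)` has `Re z > 0`; in particular `0 ∉ F(K T⁻¹)`. -/
theorem stmt16 {m n : ℕ} (A : Matrix (Fin m) (Fin n) ℝ) (μ γ : ℝ)
    (hμ : 0 ≤ μ) (hγ : 0 < γ)
    (hAA : (Aᵀ * A).IsHermitian)
    (lmin : ℝ) (hlmin : lmin = ⨅ i, hAA.eigenvalues i)
    (hlow : 0 < γ - μ ^ 2)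
    (hup : γ - μ ^ 2 < 2 * Real.sqrt γ * (μ ^ 2 + lmin) / (γ + lmin))
    (K T : Matrix (Fin m ⊕ Fin n) (Fin m ⊕ Fin n) ℝ)
    (hK : K = Matrix.fromBlocks 1 A (-Aᵀ) (μ ^ 2 • (1 : Matrix (Fin n) (Fin n) ℝ)))
    (hT : T = Matrix.fromBlocks 1 A (-Aᵀ) (γ • (1 : Matrix (Fin n) (Fin n) ℝ))) :
    (∀ z ∈ fov (K * T⁻¹), 0 < z.re) ∧ (0 : ℂ) ∉ fov (K * T⁻¹) := by
  suffices hpos : ∀ v, v ≠ 0 → 0 < v ⬝ᵥ ((K * T⁻¹) *ᵥ v) from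
    ⟨fun z hz => re_pos_of_mem_fov hpos hz, fun h0 => (re_pos_of_mem_fov hpos h0).false⟩
  have hl : 0 ≤ lmin := by
    rw [hlmin]
    refine Real.iInf_nonneg fun i => ?_
    have := Matrix.posSemidef_conjTranspose_mul_self A
    rw [conjTranspose_eq_transpose_of_trivial] at this
    exact this.eigenvalues_nonneg i
  have hray (w : Fin n → ℝ) : lmin * (w ⬝ᵥ w) ≤ (A *ᵥ w) ⬝ᵥ (A *ᵥ w) := by
    rw [hlmin, mulVec_dotProduct_self]
    exact iInf_eigenvalues_mul_le hAA w
  obtain ⟨p, hp, rfl⟩ : ∃ p : ℝ, 0 < p ∧ γ = p ^ 2 :=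
    ⟨√γ, Real.sqrt_pos.2 hγ, (Real.sq_sqrt hγ.le).symm⟩
  rw [Real.sqrt_sq hp.le, lt_div_iff₀ (by positivity)] at hup
  obtain ⟨δ, hδ⟩ : ∃ δ, δ = p ^ 2 - μ ^ 2 := ⟨_, rfl⟩
  have hμδ : μ ^ 2 = p ^ 2 - δ := by linarith
  rw [← hδ] at hlow hup
  rw [hμδ] at hK hup
  have hup' : δ * (p ^ 2 + lmin + 2 * p) < 2 * p * (p ^ 2 + lmin) := by linarith
  have hTunit : IsUnit T := by
    refine isUnit_of_dotProduct_mulVec_pos fun v hv => ?_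
    obtain ⟨x, s, rfl⟩ : ∃ x s, v = Sum.elim x s := ⟨_, _, (Sum.elim_comp_inl_inr v).symm⟩
    have hform : Sum.elim x s ⬝ᵥ (T *ᵥ Sum.elim x s) = x ⬝ᵥ x + p ^ 2 * (s ⬝ᵥ s) := by
      rw [hT, fromBlocks_mulVec]
      simp only [Sum.elim_comp_inl, Sum.elim_comp_inr, sumElim_dotProduct_sumElim, one_mulVec,
        smul_mulVec, neg_mulVec, dotProduct_add, dotProduct_neg, dotProduct_smul, smul_eq_mul]
      rw [dotProduct_mulVec s, vecMul_transpose, dotProduct_comm (A *ᵥ s)]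
      ring
    rw [hform]
    have hx := dotProduct_self_nonneg_real x
    rcases eq_or_ne s 0 with rfl | hs
    · have hx0 : x ≠ 0 := by
        rintro rfl
        exact hv (by ext i; cases i <;> rfl)
      simpa using dotProduct_self_pos_real hx0
    · have := dotProduct_self_pos_real hs
      positivity
  have hSunit : IsUnit (p ^ 2 • (1 : Matrix (Fin n) (Fin n) ℝ) + Aᵀ * A) := by
    refine isUnit_of_dotProduct_mulVec_pos fun v hv => ?_
    rw [add_mulVec, dotProduct_add, ← mulVec_dotProduct_self, smul_mulVec, one_mulVec,
      dotProduct_smul, smul_eq_mul]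
    have := dotProduct_self_pos_real hv
    have := dotProduct_self_nonneg_real (A *ᵥ v)
    positivity
  intro v hv
  obtain ⟨y, rfl⟩ := (Matrix.mulVec_surjective_iff_isUnit.2 hTunit) v
  rw [mulVec_mulVec, Matrix.mul_assoc,
    Matrix.nonsing_inv_mul _ ((Matrix.isUnit_iff_isUnit_det _).1 hTunit), Matrix.mul_one]
  obtain ⟨x, s, rfl⟩ : ∃ x s, y = Sum.elim x s := ⟨_, _, (Sum.elim_comp_inl_inr y).symm⟩
  obtain ⟨u, hu⟩ : ∃ u, u = x + A *ᵥ s := ⟨_, rfl⟩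
  obtain ⟨r, hr⟩ : ∃ r, r = -(Aᵀ *ᵥ x) + p ^ 2 • s := ⟨_, rfl⟩
  have hTy : T *ᵥ Sum.elim x s = Sum.elim u r := by
    rw [hT, fromBlocks_mulVec, hu, hr]
    simp [smul_mulVec, neg_mulVec]
  have hKy : K *ᵥ Sum.elim x s = Sum.elim u (r - δ • s) := by
    rw [hK, fromBlocks_mulVec, hu, hr]
    simp [smul_mulVec, neg_mulVec, sub_smul, sub_mulVec, add_sub_assoc]
  rw [hTy] at hv ⊢
  rw [hKy, sumElim_dotProduct_sumElim, dotProduct_sub, dotProduct_smul, smul_eq_mul]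
  obtain ⟨w, hw⟩ := (Matrix.mulVec_surjective_iff_isUnit.2 hSunit) r
  have hw' : r = p ^ 2 • w + (Aᵀ * A) *ᵥ w := by
    rw [← hw, add_mulVec, smul_mulVec, one_mulVec]
  have hsum : Aᵀ *ᵥ u + r = p ^ 2 • s + (Aᵀ * A) *ᵥ s := by
    rw [hu, hr, mulVec_add, mulVec_mulVec]
    abel
  have hsymm : s ⬝ᵥ ((Aᵀ * A) *ᵥ w) = w ⬝ᵥ ((Aᵀ * A) *ᵥ s) := by
    rw [← mulVec_mulVec, ← mulVec_mulVec, dotProduct_mulVec s, dotProduct_mulVec w,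
      vecMul_transpose, vecMul_transpose, dotProduct_comm]
  have hrs : r ⬝ᵥ s = u ⬝ᵥ (A *ᵥ w) + r ⬝ᵥ w := by
    have h1 : w ⬝ᵥ (Aᵀ *ᵥ u) = u ⬝ᵥ (A *ᵥ w) := by
      rw [dotProduct_mulVec, vecMul_transpose, dotProduct_comm]
    calc r ⬝ᵥ s = s ⬝ᵥ r := dotProduct_comm _ _
      _ = w ⬝ᵥ (p ^ 2 • s + (Aᵀ * A) *ᵥ s) := by
        rw [hw', dotProduct_add, dotProduct_add, hsymm, dotProduct_smul, dotProduct_smul,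
          dotProduct_comm s w]
      _ = u ⬝ᵥ (A *ᵥ w) + r ⬝ᵥ w := by
        rw [← hsum, dotProduct_add, h1, dotProduct_comm w r]
  rcases eq_or_ne w 0 with rfl | hw0
  · have hr0 : r = 0 := by rw [hw']; simp
    have hu0 : u ≠ 0 := by
      rintro rfl
      exact hv (by rw [hr0]; ext i; cases i <;> rfl)
    simpa [hr0] using dotProduct_self_pos_real hu0
  · have hmain := shifted_gram_pos A hp hlow hl hup' hw0 (hray w) hw'
    have hsq := dotProduct_self_nonneg_real (u - (δ / 2) • (A *ᵥ w))
    simp only [sub_dotProduct, dotProduct_sub, smul_dotProduct, dotProduct_smul, smul_eq_mul,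
      dotProduct_comm (A *ᵥ w) u] at hsq
    rw [hrs]
    linarith
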